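/- arXiv:1704.04070 — 10 statements merged into one kernel-verified Lean document; each statement's English description precedes it below -/
import Mathlib

section
/- Let c > 0, λ > 0, t ∈ ℝ, x ∈ ℝ, d_t ≥ 0 and d_x ∈ ℝ. Then the Lebesgue integral over ℝ² of exp(−2λ(t−s) − λ d_t) over the intersection A_t(x) ∩ A_{t+d_t}(x+d_x), where A_u(y) = {(ξ,s) ∈ ℝ×ℝ : s ≤ u, |y−ξ| ≤ c(u−s)}, equals (c/(2λ²)) · exp(−λ · max(d_t, |d_x|/c)). -/
open MeasureTheory Real Set

/-- The ambit set (causality cone) `A_u(y) = {(ξ,s) : s ≤ u, |y-ξ| ≤ c(u-s)}` in one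
spatial dimension, as a subset of `ℝ × ℝ` with points `p = (ξ, s)`. -/
def ambitSet (c u y : ℝ) : Set (ℝ × ℝ) :=
  {p : ℝ × ℝ | p.2 ≤ u ∧ |y - p.1| ≤ c * (u - p.2)}

lemma mem_ambitSet_iff {c : ℝ} (hc : 0 < c) {u y : ℝ} {p : ℝ × ℝ} :
    p ∈ ambitSet c u y ↔ p.1 ∈ Icc (y - c * (u - p.2)) (y + c * (u - p.2)) := by
  have h : |y - p.1| ≤ c * (u - p.2) → p.2 ≤ u := fun h =>
    sub_nonneg.1 (nonneg_of_mul_nonneg_right ((abs_nonneg _).trans h) hc)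
  simp only [ambitSet, mem_ofPred_eq, mem_Icc]
  rw [and_iff_right_of_imp h, abs_le]
  constructor <;> rintro ⟨_, _⟩ <;> constructor <;> linarith

lemma measurableSet_ambitSet (c u y : ℝ) : MeasurableSet (ambitSet c u y) := by
  unfold ambitSet
  measurability

/-- Two ambit sets with the same speed intersect in an ambit set. -/
lemma ambitSet_inter_ambitSet {c : ℝ} (hc : 0 < c) (t x dx : ℝ) {dt : ℝ} (hdt : 0 ≤ dt) :
    ∃ y, ambitSet c t x ∩ ambitSet c (t + dt) (x + dx) =
      ambitSet c (t + dt / 2 - max dt (|dx| / c) / 2) y := by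
  have hcdt : 0 ≤ c * dt := mul_nonneg hc.le hdt
  rcases le_total (|dx| / c) dt with h | h
  · refine ⟨x, ?_⟩
    rw [max_eq_left h]
    rw [div_le_iff₀ hc, abs_le] at h
    ext p
    simp only [mem_inter_iff, mem_ambitSet_iff hc, mem_Icc]
    constructor
    · rintro ⟨⟨_, _⟩, _, _⟩
      constructor <;> linarith
    · rintro ⟨_, _⟩
      refine ⟨⟨?_, ?_⟩, ?_, ?_⟩ <;> linarith
  · rw [max_eq_right h]
    have hm : c * (|dx| / c) = |dx| := mul_div_cancel₀ _ hc.ne'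
    rw [le_div_iff₀ hc] at h
    rcases abs_cases dx with ⟨hd, _⟩ | ⟨hd, _⟩
    · refine ⟨x + dx / 2 - c * dt / 2, ?_⟩
      ext p
      simp only [mem_inter_iff, mem_ambitSet_iff hc, mem_Icc]
      constructor
      · rintro ⟨⟨_, _⟩, _, _⟩
        constructor <;> linarith
      · rintro ⟨_, _⟩
        refine ⟨⟨?_, ?_⟩, ?_, ?_⟩ <;> linarith
    · refine ⟨x + dx / 2 + c * dt / 2, ?_⟩
      ext p
      simp only [mem_inter_iff, mem_ambitSet_iff hc, mem_Icc]
      constructor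
      · rintro ⟨⟨_, _⟩, _, _⟩
        constructor <;> linarith
      · rintro ⟨_, _⟩
        refine ⟨⟨?_, ?_⟩, ?_, ?_⟩ <;> linarith

lemma integral_max_mul_exp {k : ℝ} (hk : 0 < k) (u : ℝ) :
    ∫ s, max (u - s) 0 * exp (k * s) = exp (k * u) / k ^ 2 := by
  have key : ∫ r, max r 0 * exp (k * (u - r)) = exp (k * u) / k ^ 2 := by
    have h := integral_rpow_mul_exp_neg_mul_Ioi (a := 2) two_pos hk
    rw [← integral_indicator measurableSet_Ioi] at h
    have e : (fun r => max r 0 * exp (k * (u - r))) = fun r =>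
        exp (k * u) * (Ioi (0 : ℝ)).indicator (fun r => r ^ ((2 : ℝ) - 1) * exp (-(k * r))) r := by
      ext r
      by_cases hr : 0 < r
      · rw [indicator_of_mem (mem_Ioi.2 hr), max_eq_left hr.le, mul_sub, sub_eq_add_neg, exp_add]
        norm_num
        ring
      · rw [indicator_of_notMem (by simpa using hr), max_eq_right (not_lt.1 hr)]
        simp
    rw [e, integral_const_mul, h]
    norm_num
    ring
  rw [← key, ← integral_sub_left_eq_self _ _ u]
  simp

lemma setIntegral_ambitSet_exp {c k : ℝ} (hc : 0 < c) (hk : 0 < k) (u y : ℝ) :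
    ∫ p in ambitSet c u y, exp (k * p.2) = 2 * c / k ^ 2 * exp (k * u) := by
  rw [← integral_indicator (measurableSet_ambitSet c u y)]
  set f : ℝ × ℝ → ℝ := (ambitSet c u y).indicator fun p => exp (k * p.2) with hf
  have slice : ∀ s, (fun ξ => f (ξ, s)) =
      (Icc (y - c * (u - s)) (y + c * (u - s))).indicator fun _ => exp (k * s) := by
    intro s
    classical
    ext ξ
    simp only [hf, indicator_apply, mem_ambitSet_iff hc]
  have slice_integral : ∀ s, ∫ ξ, f (ξ, s) = 2 * c * (max (u - s) 0 * exp (k * s)) := by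
    intro s
    rw [slice, integral_indicator measurableSet_Icc, setIntegral_const, smul_eq_mul,
      measureReal_def, Real.volume_Icc, ENNReal.toReal_ofReal',
      show y + c * (u - s) - (y - c * (u - s)) = 2 * c * (u - s) by ring,
      ← mul_zero (2 * c), ← mul_max_of_nonneg _ _ (by positivity), mul_zero, mul_assoc]
  have outer := integral_max_mul_exp hk u
  have f_int : Integrable f (volume.prod volume) := by
    have f_meas : Measurable f :=
      Measurable.indicator (by fun_prop) (measurableSet_ambitSet c u y)
    rw [integrable_prod_iff' f_meas.aestronglyMeasurable]
    refine ⟨.of_forall fun s => ?_, ?_⟩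
    · rw [slice, integrable_indicator_iff measurableSet_Icc]
      exact integrableOn_const (by simp)
    · have nonneg : ∀ p, ‖f p‖ = f p := fun p =>
        norm_of_nonneg (indicator_nonneg (fun _ _ => (exp_pos _).le) p)
      simp_rw [nonneg, slice_integral]
      refine Integrable.const_mul (Integrable.of_integral_ne_zero ?_) _
      rw [outer]
      positivity
  rw [Measure.volume_eq_prod, integral_prod_symm _ f_int]
  simp_rw [slice_integral]
  rw [integral_const_mul, outer]
  ring

/-- The integral of `exp(-2λ(t-s) - λ d_t)` over the intersection
`A_t(x) ∩ A_{t+d_t}(x+d_x)` equals `(c/(2λ²)) exp(-λ max(d_t, |d_x|/c))`. -/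
theorem stmt2 (c l t x dt dx : ℝ) (hc : 0 < c) (hl : 0 < l) (hdt : 0 ≤ dt) :
    ∫ p in ambitSet c t x ∩ ambitSet c (t + dt) (x + dx),
        Real.exp (-2 * l * (t - p.2) - l * dt)
      = c / (2 * l ^ 2) * Real.exp (-l * max dt (|dx| / c)) := by
  obtain ⟨y, hy⟩ := ambitSet_inter_ambitSet hc t x dx hdt
  have split : ∀ s, exp (-2 * l * (t - s) - l * dt) =
      exp (-2 * l * t - l * dt) * exp (2 * l * s) := by
    intro s
    rw [← exp_add]
    ring_nf
  simp_rw [hy, split]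
  rw [integral_const_mul, setIntegral_ambitSet_exp hc (by positivity), mul_left_comm, ← exp_add]
  congr 1
  · field_simp
  · ring_nf
end

section
/- Let α > 2, β > 0, c > 0 and A ≥ 0. Then ∫₀^∞ (c/(2λ²)) e^{−λA} f_{α,β}(λ) dλ = c β^α / (2 (β+A)^{α−2} (α−2)(α−1)). -/
open MeasureTheory Real Set

/-- The Gamma(a, b) probability density: `f_{a,b}(l) = b^a / Γ(a) * l^(a-1) * exp(-b*l)`. -/
noncomputable def gammaPDF (a b l : ℝ) : ℝ :=
  b ^ a / Real.Gamma a * l ^ (a - 1) * Real.exp (-b * l)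

/-- For `α > 2`, `β > 0`, `c > 0` and `A ≥ 0`:
`∫₀^∞ (c/(2λ²)) e^{-λA} f_{α,β}(λ) dλ = cβ^α / (2(β+A)^{α-2}(α-2)(α-1))`. -/
theorem stmt3 (α β c A : ℝ) (hα : 2 < α) (hβ : 0 < β) (hc : 0 < c) (hA : 0 ≤ A) :
    ∫ l in Ioi (0 : ℝ), c / (2 * l ^ 2) * Real.exp (-l * A) * gammaPDF α β l
      = c * β ^ α / (2 * (β + A) ^ (α - 2) * (α - 2) * (α - 1)) := by
  have hα2 : 0 < α - 2 := by linarith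
  have hα1 : 0 < α - 1 := by linarith
  have hβA : 0 < β + A := by linarith
  have integrand_eq : ∀ l ∈ Ioi (0 : ℝ),
      c / (2 * l ^ 2) * Real.exp (-l * A) * gammaPDF α β l
        = c * β ^ α / (2 * Real.Gamma α) *
          (l ^ (α - 2 - 1) * Real.exp (-((β + A) * l))) := by
    intro l hl
    have hl : 0 < l := hl
    have hpow : l ^ (α - 1) = l ^ (α - 2 - 1) * l ^ 2 := by
      rw [← Real.rpow_natCast l 2, ← Real.rpow_add hl]
      congr 1
      push_cast
      ring
    have hexp : Real.exp (-((β + A) * l)) = Real.exp (-l * A) * Real.exp (-β * l) := by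
      rw [← Real.exp_add]
      congr 1
      ring
    have hΓ := (Real.Gamma_pos_of_pos (by linarith : 0 < α)).ne'
    rw [gammaPDF, hpow, hexp]
    field_simp
  have hΓ : Real.Gamma α = (α - 1) * ((α - 2) * Real.Gamma (α - 2)) := by
    rw [← Real.Gamma_add_one hα2.ne', show α - 2 + 1 = α - 1 by ring,
      ← Real.Gamma_add_one hα1.ne', sub_add_cancel]
  rw [setIntegral_congr_fun measurableSet_Ioi integrand_eq, integral_const_mul,
    Real.integral_rpow_mul_exp_neg_mul_Ioi hα2 hβA, hΓ,
    Real.div_rpow zero_le_one hβA.le, Real.one_rpow]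
  have hΓ2 := (Real.Gamma_pos_of_pos hα2).ne'
  have hpow := (Real.rpow_pos_of_pos hβA (α - 2)).ne'
  field_simp
end

section
/- Let β > 0, c > 0, V > 0 and α > 2, and define K(τ) = c β^α V / (2 (β+τ)^{α−2} (α−2)(α−1)) for τ ≥ 0. If α > 3 then ∫₀^∞ K(τ) dτ = c β³ V / (2 (α−2)(α−1)(α−3)); if 2 < α ≤ 3 then ∫₀^∞ K(τ) dτ = ∞. -/
open MeasureTheory Real Set

theorem lintegral_Ioi_rpow_of_lt {a b : ℝ} (ha : a < -1) (hb : 0 < b) :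
    ∫⁻ x in Ioi b, ENNReal.ofReal (x ^ a) = ENNReal.ofReal (-b ^ (a + 1) / (a + 1)) := by
  rw [← integral_Ioi_rpow_of_lt ha hb,
    ofReal_integral_eq_lintegral_ofReal (integrableOn_Ioi_rpow_of_lt ha hb)]
  filter_upwards [ae_restrict_mem measurableSet_Ioi] with x hx
  exact rpow_nonneg (hb.trans hx).le a

theorem lintegral_Ioi_rpow_eq_top {a b : ℝ} (ha : -1 ≤ a) (hb : 0 < b) :
    ∫⁻ x in Ioi b, ENNReal.ofReal (x ^ a) = ⊤ := by
  by_contra h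
  have hint : IntegrableOn (fun x : ℝ ↦ x ^ a) (Ioi b) := by
    refine (lintegral_ofReal_ne_top_iff_integrable (by fun_prop) ?_).1 h
    filter_upwards [ae_restrict_mem measurableSet_Ioi] with x hx
    exact rpow_nonneg (hb.trans hx).le a
  exact ha.not_gt ((integrableOn_Ioi_rpow_iff hb).1 hint)

theorem lintegral_Ioi_zero_comp_add_left (f : ℝ → ENNReal) (b : ℝ) :
    ∫⁻ x in Ioi (0 : ℝ), f (b + x) = ∫⁻ x in Ioi b, f x := by
  have h := (measurePreserving_add_left volume b).setLIntegral_comp_preimage_emb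
    (measurableEmbedding_addLeft b) f (Ioi b)
  simpa using h

theorem lintegral_autocovariance {β c V α : ℝ} (hβ : 0 < β) (hc : 0 < c) (hV : 0 < V)
    (hα : 2 < α) :
    ∫⁻ τ in Ioi (0 : ℝ),
        ENNReal.ofReal (c * β ^ α * V / (2 * (β + τ) ^ (α - 2) * (α - 2) * (α - 1)))
      = ENNReal.ofReal (c * β ^ α * V / (2 * (α - 2) * (α - 1))) *
        ∫⁻ x in Ioi β, ENNReal.ofReal (x ^ (2 - α)) := by
  have h2 : 0 < α - 2 := by linarith
  have h1 : 0 < α - 1 := by linarith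
  rw [← lintegral_const_mul _ (by fun_prop), ← lintegral_Ioi_zero_comp_add_left _ β]
  refine setLIntegral_congr_fun measurableSet_Ioi fun τ hτ ↦ ?_
  have hpos : 0 < β + τ := add_pos hβ hτ
  have hpow := rpow_pos_of_pos hpos (α - 2)
  rw [← ENNReal.ofReal_mul (by positivity), ← neg_sub α 2, rpow_neg hpos.le]
  congr 1
  field_simp

/-- Temporal (short/long)-range dependence for the temporal autocovariance
`K(τ) = cβ^αV / (2(β+τ)^{α-2}(α-2)(α-1))`: if `α > 3` the integral over `(0,∞)` equals
`cβ³V / (2(α-2)(α-1)(α-3))`, while for `2 < α ≤ 3` it is infinite. -/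
theorem stmt4 (β c V α : ℝ) (hβ : 0 < β) (hc : 0 < c) (hV : 0 < V) (hα : 2 < α) :
    (3 < α →
      ∫⁻ τ in Ioi (0 : ℝ),
          ENNReal.ofReal (c * β ^ α * V / (2 * (β + τ) ^ (α - 2) * (α - 2) * (α - 1)))
        = ENNReal.ofReal (c * β ^ 3 * V / (2 * (α - 2) * (α - 1) * (α - 3)))) ∧
    (α ≤ 3 →
      ∫⁻ τ in Ioi (0 : ℝ),
          ENNReal.ofReal (c * β ^ α * V / (2 * (β + τ) ^ (α - 2) * (α - 2) * (α - 1)))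
        = ⊤) := by
  have h2 : 0 < α - 2 := by linarith
  have h1 : 0 < α - 1 := by linarith
  have hC : 0 < c * β ^ α * V / (2 * (α - 2) * (α - 1)) := by positivity
  rw [lintegral_autocovariance hβ hc hV hα]
  refine ⟨fun h ↦ ?_, fun h ↦ ?_⟩
  · have h3 : α - 3 ≠ 0 := (sub_pos.2 h).ne'
    rw [lintegral_Ioi_rpow_of_lt (by linarith) hβ, ← ENNReal.ofReal_mul hC.le]
    congr 1
    have hpow : β ^ α * β ^ (2 - α + 1) = β ^ 3 := by
      rw [← rpow_add hβ, ← rpow_natCast]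
      congr 1
      push_cast
      ring
    rw [← hpow, show 2 - α + 1 = -(α - 3) by ring]
    field_simp
  · rw [lintegral_Ioi_rpow_eq_top (by linarith) hβ,
      ENNReal.mul_top (ENNReal.ofReal_pos.2 hC).ne']
end

section
/- Let β > 0, c > 0, V > 0 and α > 2, and define C(r) = c β^α V / (2 (β+r/c)^{α−2} (α−2)(α−1)) for r ≥ 0. If α > 3 then ∫₀^∞ C(r) dr = c² β³ V / (2 (α−2)(α−1)(α−3)); if 2 < α ≤ 3 then ∫₀^∞ C(r) dr = ∞. -/
open MeasureTheory Real Set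

/-- A translated power on `(0, ∞)` has the same lower integral as the power itself on `(m, ∞)`. -/
theorem lintegral_Ioi_const_mul_add_rpow (K m s : ℝ) :
    ∫⁻ r in Ioi (0 : ℝ), ENNReal.ofReal (K * (r + m) ^ s) =
      ∫⁻ x in Ioi m, ENNReal.ofReal (K * x ^ s) := by
  have h := (measurePreserving_add_right volume m).setLIntegral_comp_preimage_emb
    (measurableEmbedding_addRight m) (fun x => ENNReal.ofReal (K * x ^ s)) (Ioi m)
  simpa using h

theorem lintegral_Ioi_const_mul_rpow_of_lt {K m s : ℝ} (hK : 0 ≤ K) (hm : 0 < m) (hs : s < -1) :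
    ∫⁻ x in Ioi m, ENNReal.ofReal (K * x ^ s) =
      ENNReal.ofReal (K * (-m ^ (s + 1) / (s + 1))) := by
  rw [← integral_Ioi_rpow_of_lt hs hm, ← integral_const_mul,
    ofReal_integral_eq_lintegral_ofReal ((integrableOn_Ioi_rpow_of_lt hs hm).const_mul K)]
  filter_upwards [ae_restrict_mem measurableSet_Ioi] with x hx
  exact mul_nonneg hK (rpow_nonneg (hm.trans hx).le s)

theorem lintegral_Ioi_const_mul_rpow_eq_top {K m s : ℝ} (hK : 0 < K) (hm : 0 < m) (hs : -1 ≤ s) :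
    ∫⁻ x in Ioi m, ENNReal.ofReal (K * x ^ s) = ⊤ := by
  by_contra h
  have hmeas : AEStronglyMeasurable (fun x : ℝ => K * x ^ s) (volume.restrict (Ioi m)) := by
    fun_prop
  have hnonneg : 0 ≤ᵐ[volume.restrict (Ioi m)] fun x : ℝ => K * x ^ s := by
    filter_upwards [ae_restrict_mem measurableSet_Ioi] with x hx
    exact mul_nonneg hK.le (rpow_nonneg (hm.trans hx).le s)
  have hint := (lintegral_ofReal_ne_top_iff_integrable hmeas hnonneg).1 h
  rw [integrable_const_mul_iff hK.ne'.isUnit] at hint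
  exact hs.not_gt ((integrableOn_Ioi_rpow_iff hm).1 hint)

/-- Spatial (short/long)-range dependence for the spatial covariance
`C(r) = cβ^αV / (2(β+r/c)^{α-2}(α-2)(α-1))`: if `α > 3` the integral over `(0,∞)` equals
`c²β³V / (2(α-2)(α-1)(α-3))`, while for `2 < α ≤ 3` it is infinite. -/
theorem stmt5 (β c V α : ℝ) (hβ : 0 < β) (hc : 0 < c) (hV : 0 < V) (hα : 2 < α) :
    (3 < α →
      ∫⁻ r in Ioi (0 : ℝ),
          ENNReal.ofReal (c * β ^ α * V / (2 * (β + r / c) ^ (α - 2) * (α - 2) * (α - 1)))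
        = ENNReal.ofReal (c ^ 2 * β ^ 3 * V / (2 * (α - 2) * (α - 1) * (α - 3)))) ∧
    (α ≤ 3 →
      ∫⁻ r in Ioi (0 : ℝ),
          ENNReal.ofReal (c * β ^ α * V / (2 * (β + r / c) ^ (α - 2) * (α - 2) * (α - 1)))
        = ⊤) := by
  have h₁ : 0 < α - 2 := by linarith
  have h₂ : 0 < α - 1 := by linarith
  have hm : 0 < c * β := mul_pos hc hβ
  set K : ℝ := c * β ^ α * V * c ^ (α - 2) / (2 * (α - 2) * (α - 1)) with hKdef
  have hK : 0 < K := by positivity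
  have key : ∫⁻ r in Ioi (0 : ℝ),
      ENNReal.ofReal (c * β ^ α * V / (2 * (β + r / c) ^ (α - 2) * (α - 2) * (α - 1))) =
        ∫⁻ x in Ioi (c * β), ENNReal.ofReal (K * x ^ (2 - α)) := by
    rw [← lintegral_Ioi_const_mul_add_rpow]
    refine setLIntegral_congr_fun measurableSet_Ioi fun r hr => ?_
    have hr : 0 < r := hr
    have hpos : 0 < r + c * β := by positivity
    have hrc : β + r / c = (r + c * β) / c := by field_simp; ring
    have hneg : (2 - α) = -(α - 2) := by ring
    have hpow : 0 < (r + c * β) ^ (α - 2) := rpow_pos_of_pos hpos _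
    have hcpow : 0 < c ^ (α - 2) := rpow_pos_of_pos hc _
    simp only [hKdef]
    rw [hrc, div_rpow hpos.le hc.le, hneg, rpow_neg hpos.le]
    congr 1
    field_simp
  rw [key]
  refine ⟨fun hα3 => ?_, fun hα3 =>
    lintegral_Ioi_const_mul_rpow_eq_top hK hm (by linarith)⟩
  rw [lintegral_Ioi_const_mul_rpow_of_lt hK.le hm (by linarith)]
  have h₃ : 0 < α - 3 := by linarith
  have hexp : 2 - α + 1 = -(α - 3) := by ring
  have hcp : c ^ (α - 2) = c * c ^ (α - 3) := by
    rw [← rpow_one_add' hc.le (by linarith)]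
    ring_nf
  have hβp : β ^ α = β ^ 3 * β ^ (α - 3) := by
    rw [← rpow_natCast, ← rpow_add hβ]
    norm_num
  have hc3 : 0 < c ^ (α - 3) := rpow_pos_of_pos hc _
  have hβ3 : 0 < β ^ (α - 3) := rpow_pos_of_pos hβ _
  rw [hKdef, hexp, rpow_neg hm.le, mul_rpow hc.le hβ.le, hcp, hβp]
  congr 1
  field_simp
end

section
/- Let α > 4, β > 0, c > 0 and r ≥ 0. Then ∫₀^∞ (λr + 2c) λ^{−4} e^{−λr/c} f_{α,β}(λ) dλ = β^α c^{α−3} (βc + r)^{3−α} (2βc + (α−2)r) / ((α−4)(α−3)(α−2)(α−1)). -/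
open MeasureTheory Real Set

theorem integrableOn_rpow_sub_one_mul_exp_neg_mul {a b : ℝ} (ha : 0 < a) (hb : 0 < b) :
    IntegrableOn (fun x : ℝ => x ^ (a - 1) * Real.exp (-(b * x))) (Ioi 0) := by
  simpa using integrableOn_rpow_mul_exp_neg_mul_rpow (by linarith : -1 < a - 1) one_pos hb

theorem Real.Gamma_eq_mul_Gamma_sub_one {x : ℝ} (hx : x - 1 ≠ 0) :
    Real.Gamma x = (x - 1) * Real.Gamma (x - 1) := by
  simpa using Real.Gamma_add_one hx

/-- For `α > 4`, `β > 0`, `c > 0` and `r ≥ 0`: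
`∫₀^∞ (λr + 2c) λ^{-4} e^{-λr/c} f_{α,β}(λ) dλ
  = β^α c^{α-3} (βc + r)^{3-α} (2βc + (α-2)r) / ((α-4)(α-3)(α-2)(α-1))`. -/
theorem stmt7 (α β c r : ℝ) (hα : 4 < α) (hβ : 0 < β) (hc : 0 < c) (hr : 0 ≤ r) :
    ∫ l in Ioi (0 : ℝ),
        (l * r + 2 * c) * (l ^ 4)⁻¹ * Real.exp (-l * r / c) * gammaPDF α β l
      = β ^ α * c ^ (α - 3) * (β * c + r) ^ (3 - α) * (2 * β * c + (α - 2) * r) /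
          ((α - 4) * (α - 3) * (α - 2) * (α - 1)) := by
  have hs : 0 < β * c + r := by positivity
  have hb : 0 < (β * c + r) / c := by positivity
  have hG : Real.Gamma (α - 4) ≠ 0 := (Real.Gamma_pos_of_pos (by linarith)).ne'
  have hG3 : Real.Gamma (α - 3) = (α - 4) * Real.Gamma (α - 4) := by
    rw [Real.Gamma_eq_mul_Gamma_sub_one (by linarith)]
    ring_nf
  have hGα : Real.Gamma α =
      (α - 1) * ((α - 2) * ((α - 3) * ((α - 4) * Real.Gamma (α - 4)))) := by
    rw [← hG3, Real.Gamma_eq_mul_Gamma_sub_one (x := α) (by linarith),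
      Real.Gamma_eq_mul_Gamma_sub_one (x := α - 1) (by linarith),
      Real.Gamma_eq_mul_Gamma_sub_one (x := α - 1 - 1) (by linarith)]
    ring_nf
  have hI : ∀ l ∈ Ioi (0 : ℝ),
      (l * r + 2 * c) * (l ^ 4)⁻¹ * Real.exp (-l * r / c) * gammaPDF α β l =
        β ^ α / Real.Gamma α * r *
            (l ^ (α - 3 - 1) * Real.exp (-((β * c + r) / c * l))) +
          β ^ α / Real.Gamma α * (2 * c) *
            (l ^ (α - 4 - 1) * Real.exp (-((β * c + r) / c * l))) := by
    intro l (hl : 0 < l)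
    have hexp : Real.exp (-((β * c + r) / c * l)) =
        Real.exp (-l * r / c) * Real.exp (-β * l) := by
      rw [← Real.exp_add]
      congr 1
      field_simp
      ring
    have h3 : l ^ (α - 3 - 1) = l ^ (α - 4 - 1) * l := by
      rw [← Real.rpow_add_one hl.ne']
      ring_nf
    have h1 : l ^ (α - 1) = l ^ (α - 4 - 1) * l ^ 4 := by
      rw [← Real.rpow_add_natCast hl.ne']
      push_cast
      ring_nf
    rw [gammaPDF, hexp, h3, h1]
    field_simp
  have hint3 := integrableOn_rpow_sub_one_mul_exp_neg_mul (by linarith : 0 < α - 3) hb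
  have hint4 := integrableOn_rpow_sub_one_mul_exp_neg_mul (by linarith : 0 < α - 4) hb
  rw [setIntegral_congr_fun measurableSet_Ioi hI,
    integral_add (hint3.const_mul _) (hint4.const_mul _), integral_const_mul,
    integral_const_mul, Real.integral_rpow_mul_exp_neg_mul_Ioi (by linarith) hb,
    Real.integral_rpow_mul_exp_neg_mul_Ioi (by linarith) hb, hGα, hG3]
  have hpow4 : (1 / ((β * c + r) / c)) ^ (α - 4) =
      (1 / ((β * c + r) / c)) ^ (α - 3) * ((β * c + r) / c) := by
    rw [show α - 4 = α - 3 - 1 by ring, Real.rpow_sub_one (by positivity)]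
    field_simp
  have hpow3 : (1 / ((β * c + r) / c)) ^ (α - 3) =
      c ^ (α - 3) * (β * c + r) ^ (3 - α) := by
    rw [one_div_div, Real.div_rpow hc.le hs.le, div_eq_mul_inv, ← Real.rpow_neg hs.le, neg_sub]
  rw [hpow4, hpow3]
  have h1 : α - 1 ≠ 0 := by linarith
  have h2 : α - 2 ≠ 0 := by linarith
  have h3 : α - 3 ≠ 0 := by linarith
  have h4 : α - 4 ≠ 0 := by linarith
  field_simp
  ring
end

section
/- Let β > 0, c > 0 and α > 4, and define u(r) = (1 + r/(βc))^{3−α} (1 + (α−2)r/(2βc)) for r ≥ 0. If α > 5 then ∫₀^∞ u(r) dr = 3βc/(2(α−5)); if 4 < α ≤ 5 then ∫₀^∞ u(r) dr = ∞. -/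
open MeasureTheory Real Set

open Filter Topology in
/-- The covariance function with `k = βc` has the stated integral when `5 < α`. -/
lemma lintegral_covariance_of_five_lt {k α : ℝ} (hk : 0 < k) (hα : 5 < α) :
    ∫⁻ r in Ioi (0 : ℝ), ENNReal.ofReal ((1 + r / k) ^ (3 - α) * (1 + (α - 2) * r / (2 * k)))
      = ENNReal.ofReal (3 * k / (2 * (α - 5))) := by
  set F : ℝ → ℝ := fun r ↦ k * ((α - 2) / (2 * (5 - α)) * (1 + r / k) ^ (5 - α)
    + 1 / 2 * (1 + r / k) ^ (4 - α)) with hF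
  have h5 : 5 - α ≠ 0 := by linarith
  have h5' : α - 5 ≠ 0 := by linarith
  have hderiv : ∀ r ∈ Ici (0 : ℝ),
      HasDerivAt F ((1 + r / k) ^ (3 - α) * (1 + (α - 2) * r / (2 * k))) r := by
    intro r hr
    have hs : 0 < 1 + r / k := by
      have : 0 ≤ r / k := div_nonneg hr hk.le
      linarith
    have hlin : HasDerivAt (fun r : ℝ ↦ 1 + r / k) (1 / k) r :=
      ((hasDerivAt_id r).div_const k).const_add 1
    have h1 := hlin.rpow_const (p := 5 - α) (Or.inl hs.ne')
    have h2 := hlin.rpow_const (p := 4 - α) (Or.inl hs.ne')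
    refine (((h1.const_mul ((α - 2) / (2 * (5 - α)))).add
      (h2.const_mul (1 / 2))).const_mul k).congr_deriv ?_
    have e1 : (1 + r / k) ^ (5 - α - 1) = (1 + r / k) ^ (3 - α) * (1 + r / k) := by
      rw [← rpow_add_one hs.ne']
      ring_nf
    rw [e1, show 4 - α - 1 = 3 - α by ring]
    generalize (1 + r / k) ^ (3 - α) = p
    field_simp
    ring
  have hpos : ∀ r ∈ Ioi (0 : ℝ), 0 ≤ (1 + r / k) ^ (3 - α) * (1 + (α - 2) * r / (2 * k)) := by
    intro r hr
    have hr : 0 < r := hr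
    have : 0 < α - 2 := by linarith
    positivity
  have hlim : Tendsto F atTop (𝓝 0) := by
    have hs : Tendsto (fun r : ℝ ↦ 1 + r / k) atTop atTop :=
      tendsto_atTop_add_const_left _ _ (tendsto_id.atTop_div_const hk)
    have h1 := (tendsto_rpow_neg_atTop (y := α - 5) (by linarith)).comp hs
    have h2 := (tendsto_rpow_neg_atTop (y := α - 4) (by linarith)).comp hs
    simpa only [hF, Function.comp_def, neg_sub, mul_zero, add_zero] using
      ((h1.const_mul ((α - 2) / (2 * (5 - α)))).add (h2.const_mul (1 / 2))).const_mul k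
  have hint := integrableOn_Ioi_deriv_of_nonneg' hderiv hpos hlim
  rw [← ofReal_integral_eq_lintegral_ofReal hint
      ((ae_restrict_iff' measurableSet_Ioi).2 (Eventually.of_forall hpos)),
    integral_Ioi_of_hasDerivAt_of_nonneg' hderiv hpos hlim]
  congr 1
  simp only [hF, zero_div, add_zero, one_rpow]
  rw [show 5 - α = -(α - 5) by ring]
  field_simp
  ring

/-- The covariance function with `k = βc` has infinite integral when `4 < α ≤ 5`. -/
lemma lintegral_covariance_eq_top {k α : ℝ} (hk : 0 < k) (hα : 4 < α) (hα' : α ≤ 5) :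
    ∫⁻ r in Ioi (0 : ℝ), ENNReal.ofReal ((1 + r / k) ^ (3 - α) * (1 + (α - 2) * r / (2 * k)))
      = ⊤ := by
  by_contra h
  refine not_integrableOn_Ioi_inv (a := k) ?_
  have hmeas : Measurable
      fun r : ℝ ↦ (1 + r / k) ^ (3 - α) * (1 + (α - 2) * r / (2 * k)) := by fun_prop
  have hpos : ∀ r ∈ Ioi (0 : ℝ), 0 ≤ (1 + r / k) ^ (3 - α) * (1 + (α - 2) * r / (2 * k)) := by
    intro r hr
    have hr : 0 < r := hr
    have : 0 < α - 2 := by linarith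
    positivity
  have hint : IntegrableOn
      (fun r : ℝ ↦ (1 + r / k) ^ (3 - α) * (1 + (α - 2) * r / (2 * k))) (Ioi 0) :=
    (lintegral_ofReal_ne_top_iff_integrable hmeas.aestronglyMeasurable
      ((ae_restrict_iff' measurableSet_Ioi).2 (Filter.Eventually.of_forall hpos))).1 h
  refine ((hint.mono_set (Ioi_subset_Ioi hk.le)).const_mul (2 / k)).mono'
    measurable_inv.aestronglyMeasurable
    ((ae_restrict_iff' measurableSet_Ioi).2 (Filter.Eventually.of_forall fun r hr ↦ ?_))
  have hr : k < r := hr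
  have hr0 : 0 < r := hk.trans hr
  have hs : 1 ≤ 1 + r / k := by
    have : 0 < r / k := by positivity
    linarith
  have hs0 : 0 < 1 + r / k := by linarith
  have h1 : (1 + r / k) ^ (-2 : ℝ) ≤ (1 + r / k) ^ (3 - α) :=
    rpow_le_rpow_of_exponent_le hs (by linarith)
  have h2 : 1 + r / k ≤ 1 + (α - 2) * r / (2 * k) := by
    rw [show (α - 2) * r / (2 * k) = (α - 2) / 2 * (r / k) by field_simp]
    nlinarith [div_pos hr0 hk]
  have h3 : (1 + r / k) ^ (-2 : ℝ) * (1 + r / k) = k / (k + r) := by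
    rw [← rpow_add_one hs0.ne', show (-2 + 1 : ℝ) = -1 by norm_num, rpow_neg_one]
    field_simp
  rw [norm_of_nonneg (by positivity)]
  calc r⁻¹ ≤ 2 / k * (k / (k + r)) := by
        rw [div_mul_div_cancel₀ hk.ne', inv_eq_one_div, div_le_div_iff₀ hr0 (by positivity)]
        linarith
    _ ≤ _ := by
        rw [← h3]
        gcongr

/-- For `β > 0`, `c > 0`, `α > 4` and `u(r) = (1 + r/(βc))^{3-α}(1 + (α-2)r/(2βc))`:
if `α > 5` then `∫₀^∞ u(r) dr = 3βc/(2(α-5))`; if `4 < α ≤ 5` the integral is infinite. -/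
theorem stmt10 (β c α : ℝ) (hβ : 0 < β) (hc : 0 < c) (hα : 4 < α) :
    (5 < α →
      ∫⁻ r in Ioi (0 : ℝ),
          ENNReal.ofReal ((1 + r / (β * c)) ^ (3 - α) * (1 + (α - 2) * r / (2 * β * c)))
        = ENNReal.ofReal (3 * β * c / (2 * (α - 5)))) ∧
    (α ≤ 5 →
      ∫⁻ r in Ioi (0 : ℝ),
          ENNReal.ofReal ((1 + r / (β * c)) ^ (3 - α) * (1 + (α - 2) * r / (2 * β * c)))
        = ⊤) := by
  have e : ∀ r : ℝ, (α - 2) * r / (2 * β * c) = (α - 2) * r / (2 * (β * c)) := fun r ↦ by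
    rw [mul_assoc]
  simp only [e, mul_assoc 3 β c]
  exact ⟨lintegral_covariance_of_five_lt (mul_pos hβ hc),
    lintegral_covariance_eq_top (mul_pos hβ hc) hα⟩
end

section
/- Let α > 2, β > 0 and B ≥ 0. Then ∫₀^∞ λ^{−2} (Bλ + 1) e^{−Bλ} f_{α,β}(λ) dλ = (β^α/(α−1)) · [ B/(β+B)^{α−1} + 1/((α−2)(β+B)^{α−2}) ]. In particular, for fixed α, β the right-hand side tends to 0 as B → ∞. -/
open MeasureTheory Real Set

theorem integrableOn_rpow_sub_one_mul_exp_neg_mul_Ioi {a r : ℝ} (ha : 0 < a) (hr : 0 < r) :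
    IntegrableOn (fun t : ℝ => t ^ (a - 1) * Real.exp (-(r * t))) (Ioi 0) := by
  have h := integrableOn_rpow_mul_exp_neg_mul_rpow (p := 1) (s := a - 1) (b := r)
    (by linarith) one_pos hr
  simpa only [Real.rpow_one, neg_mul] using h

theorem inv_sq_mul_gammaPDF_eq (α β B : ℝ) {l : ℝ} (hl : 0 < l) :
    (l ^ 2)⁻¹ * (B * l + 1) * Real.exp (-B * l) * gammaPDF α β l
      = β ^ α / Real.Gamma α * B * (l ^ (α - 1 - 1) * Real.exp (-((β + B) * l)))
        + β ^ α / Real.Gamma α * (l ^ (α - 2 - 1) * Real.exp (-((β + B) * l))) := by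
  have hexp : Real.exp (-((β + B) * l)) = Real.exp (-B * l) * Real.exp (-β * l) := by
    rw [← Real.exp_add]
    ring_nf
  have h₁ : l ^ (α - 1) = l ^ (α - 2 - 1) * l ^ 2 := by
    rw [← Real.rpow_add_natCast hl.ne']
    push_cast
    ring_nf
  have h₂ : l ^ (α - 1 - 1) = l ^ (α - 2 - 1) * l := by
    rw [← Real.rpow_add_one hl.ne']
    ring_nf
  rw [gammaPDF, hexp, h₁, h₂]
  field_simp

theorem tendsto_add_rpow_neg_atTop (β : ℝ) {p : ℝ} (hp : 0 < p) :
    Filter.Tendsto (fun x : ℝ => (β + x) ^ (-p)) Filter.atTop (nhds 0) :=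
  (tendsto_rpow_neg_atTop hp).comp (Filter.tendsto_atTop_add_const_left _ β Filter.tendsto_id)

/-- For `α > 2`, `β > 0` and `B ≥ 0`:
`∫₀^∞ λ^{-2}(Bλ + 1)e^{-Bλ} f_{α,β}(λ) dλ
  = (β^α/(α-1)) [B/(β+B)^{α-1} + 1/((α-2)(β+B)^{α-2})]`,
and the right-hand side tends to `0` as `B → ∞`. -/
theorem stmt11 (α β B : ℝ) (hα : 2 < α) (hβ : 0 < β) (hB : 0 ≤ B) :
    (∫ l in Ioi (0 : ℝ),
        (l ^ 2)⁻¹ * (B * l + 1) * Real.exp (-B * l) * gammaPDF α β l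
      = β ^ α / (α - 1) *
          (B / (β + B) ^ (α - 1) + 1 / ((α - 2) * (β + B) ^ (α - 2)))) ∧
    Filter.Tendsto
      (fun B' : ℝ => β ^ α / (α - 1) *
          (B' / (β + B') ^ (α - 1) + 1 / ((α - 2) * (β + B') ^ (α - 2))))
      Filter.atTop (nhds 0) := by
  constructor
  · have hs : 0 < β + B := by linarith
    have h₁ : 0 < α - 1 := by linarith
    have h₂ : 0 < α - 2 := by linarith
    rw [setIntegral_congr_fun measurableSet_Ioi
        (fun l (hl : 0 < l) => inv_sq_mul_gammaPDF_eq α β B hl),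
      integral_add ((integrableOn_rpow_sub_one_mul_exp_neg_mul_Ioi h₁ hs).const_mul _)
        ((integrableOn_rpow_sub_one_mul_exp_neg_mul_Ioi h₂ hs).const_mul _),
      integral_const_mul, integral_const_mul,
      integral_rpow_mul_exp_neg_mul_Ioi h₁ hs, integral_rpow_mul_exp_neg_mul_Ioi h₂ hs,
      one_div, Real.inv_rpow hs.le, Real.inv_rpow hs.le]
    have hΓα : Real.Gamma α = (α - 1) * Real.Gamma (α - 1) := by
      rw [← Real.Gamma_add_one h₁.ne', sub_add_cancel]
    have hΓ : Real.Gamma (α - 1) = (α - 2) * Real.Gamma (α - 2) := by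
      rw [← Real.Gamma_add_one h₂.ne']
      ring_nf
    have hΓpos := Real.Gamma_pos_of_pos h₂
    have hp₁ := Real.rpow_pos_of_pos hs (α - 1)
    have hp₂ := Real.rpow_pos_of_pos hs (α - 2)
    rw [hΓα, hΓ]
    field_simp
  · have h₁ := tendsto_add_rpow_neg_atTop β (show 0 < α - 1 by linarith)
    have h₂ := tendsto_add_rpow_neg_atTop β (show 0 < α - 2 by linarith)
    have key := ((h₂.sub (h₁.const_mul β)).add (h₂.const_mul (α - 2)⁻¹)).const_mul
      (β ^ α / (α - 1))
    simp only [mul_zero, sub_zero, add_zero] at key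
    refine key.congr' ?_
    filter_upwards [Filter.eventually_ge_atTop 0] with x hx
    have hs : 0 < β + x := by linarith
    have hpow : (β + x) ^ (α - 1) = (β + x) ^ (α - 2) * (β + x) := by
      rw [← Real.rpow_add_one hs.ne']
      ring_nf
    have hp := Real.rpow_pos_of_pos hs (α - 2)
    rw [Real.rpow_neg hs.le, Real.rpow_neg hs.le, hpow]
    field_simp
    ring
end

section
/- Let d be a positive natural number, t ∈ ℝ, x ∈ ℝ^d, λ > 0, T > 0, X > 0, let g: [0,∞) → [0,∞) be nondecreasing and measurable, and let W ≥ 0 satisfy W ≤ T and g(W) ≤ X. Let A = {(ξ,s) ∈ ℝ^d × ℝ : s ≤ t, |x−ξ| ≤ g(t−s)} (with |·| the Euclidean norm) and let Q = ∏_{i=1}^d [x_i − X, x_i + X] × [t−T, t]. Then ∫_{A \ Q} e^{−2λ(t−s)} dξ ds ≤ (π^{d/2}/Γ(d/2 + 1)) ∫_W^∞ g(w)^d e^{−2λw} dw. -/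
open MeasureTheory Real Set

/-- The integral over a measurable time-dependent family of balls, of a function of the time lag,
computed by slicing at each lag. -/
theorem lintegral_slices_closedBall (d : ℕ) (hd : 0 < d) (t W : ℝ)
    (x : EuclideanSpace ℝ (Fin d)) {g : ℝ → ℝ} (hg : Measurable g) {f : ℝ → ENNReal}
    (hf : Measurable f) :
    ∫⁻ p in {p : EuclideanSpace ℝ (Fin d) × ℝ | W < t - p.2 ∧ ‖x - p.1‖ ≤ g (t - p.2)},
        f (t - p.2) =
      ENNReal.ofReal (π ^ ((d : ℝ) / 2) / Real.Gamma ((d : ℝ) / 2 + 1)) *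
        ∫⁻ w in Ioi W, ENNReal.ofReal (g w) ^ d * f w := by
  have : Nonempty (Fin d) := ⟨⟨0, hd⟩⟩
  have hS : MeasurableSet
      {p : EuclideanSpace ℝ (Fin d) × ℝ | W < t - p.2 ∧ ‖x - p.1‖ ≤ g (t - p.2)} :=
    MeasurableSet.inter (s₁ := {p : EuclideanSpace ℝ (Fin d) × ℝ | W < t - p.2})
      (s₂ := {p | ‖x - p.1‖ ≤ g (t - p.2)})
      (measurableSet_lt (by fun_prop) (by fun_prop))
      (measurableSet_le (by fun_prop) (by fun_prop))
  have hc : √π ^ d = π ^ ((d : ℝ) / 2) := by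
    rw [Real.sqrt_eq_rpow, ← Real.rpow_mul_natCast pi_pos.le]
    congr 1
    ring
  have hslice (s : ℝ) :
      ∫⁻ ξ, {p : EuclideanSpace ℝ (Fin d) × ℝ |
          W < t - p.2 ∧ ‖x - p.1‖ ≤ g (t - p.2)}.indicator (fun p => f (t - p.2)) (ξ, s) =
        (Ioi W).indicator (fun w =>
          ENNReal.ofReal (π ^ ((d : ℝ) / 2) / Real.Gamma ((d : ℝ) / 2 + 1)) *
            (ENNReal.ofReal (g w) ^ d * f w)) (t - s) := by
    by_cases hs : W < t - s
    · have hball : (fun ξ => {p : EuclideanSpace ℝ (Fin d) × ℝ |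
          W < t - p.2 ∧ ‖x - p.1‖ ≤ g (t - p.2)}.indicator (fun p => f (t - p.2)) (ξ, s)) =
          (Metric.closedBall x (g (t - s))).indicator (fun _ => f (t - s)) := by
        classical
        ext ξ
        simp [indicator_apply, hs, dist_comm ξ x, EuclideanSpace.dist_eq, EuclideanSpace.norm_eq, Real.dist_eq]
      rw [hball, lintegral_indicator_const Metric.isClosed_closedBall.measurableSet,
        EuclideanSpace.volume_closedBall, indicator_of_mem (mem_Ioi.mpr hs), Fintype.card_fin, hc]
      ring
    · simp [hs]
  rw [← lintegral_indicator hS, Measure.volume_eq_prod, lintegral_prod_symm _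
    ((Measurable.indicator (by fun_prop) hS).aemeasurable), lintegral_congr hslice,
    lintegral_sub_left_eq_self
      ((Ioi W).indicator (fun w =>
        ENNReal.ofReal (π ^ ((d : ℝ) / 2) / Real.Gamma ((d : ℝ) / 2 + 1)) *
          (ENNReal.ofReal (g w) ^ d * f w))) t,
    lintegral_indicator measurableSet_Ioi, lintegral_const_mul _ (by fun_prop)]

/-- Deterministic core of the mean-squared-error bound for simulating a g-class
spatio-temporal shot noise process: the integral of `e^{-2λ(t-s)}` over the part of the
ambit set `A = {(ξ,s) : s ≤ t, |x-ξ| ≤ g(t-s)}` outside the padded simulation box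
`Q = ∏ᵢ [xᵢ - X, xᵢ + X] × [t-T, t]` is bounded by
`(π^{d/2}/Γ(d/2+1)) ∫_W^∞ g(w)^d e^{-2λw} dw` whenever `W ≥ 0`, `W ≤ T`, `g(W) ≤ X`. -/
theorem stmt12 (d : ℕ) (hd : 0 < d) (t : ℝ) (x : EuclideanSpace ℝ (Fin d))
    (l T X W : ℝ) (hl : 0 < l) (hT : 0 < T) (hX : 0 < X)
    (g : ℝ → ℝ) (hg_mono : MonotoneOn g (Ici 0)) (hg_nonneg : ∀ w, 0 ≤ w → 0 ≤ g w)
    (hg_meas : Measurable g)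
    (hW : 0 ≤ W) (hWT : W ≤ T) (hgWX : g W ≤ X) :
    ∫⁻ p in
        {p : EuclideanSpace ℝ (Fin d) × ℝ | p.2 ≤ t ∧ ‖x - p.1‖ ≤ g (t - p.2)} \
          ({ξ : EuclideanSpace ℝ (Fin d) | ∀ i, ξ i ∈ Icc (x i - X) (x i + X)} ×ˢ
            Icc (t - T) t),
        ENNReal.ofReal (Real.exp (-2 * l * (t - p.2)))
      ≤ ENNReal.ofReal (π ^ ((d : ℝ) / 2) / Real.Gamma ((d : ℝ) / 2 + 1)) *
          ∫⁻ w in Ioi W, ENNReal.ofReal (g w ^ d * Real.exp (-2 * l * w)) := by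
  have hsub : {p : EuclideanSpace ℝ (Fin d) × ℝ | p.2 ≤ t ∧ ‖x - p.1‖ ≤ g (t - p.2)} \
      ({ξ : EuclideanSpace ℝ (Fin d) | ∀ i, ξ i ∈ Icc (x i - X) (x i + X)} ×ˢ Icc (t - T) t) ⊆
      {p | W < t - p.2 ∧ ‖x - p.1‖ ≤ g (t - p.2)} := by
    rintro ⟨ξ, s⟩ ⟨⟨hs, hξ⟩, hQ⟩
    refine ⟨?_, hξ⟩
    by_contra! hw
    dsimp only at hs hξ hw
    have hgX : g (t - s) ≤ X :=
      (hg_mono (mem_Ici.mpr (sub_nonneg.mpr hs)) (mem_Ici.mpr hW) hw).trans hgWX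
    refine hQ ⟨fun i => ?_, by linarith, hs⟩
    have hi : |x i - ξ i| ≤ X := (PiLp.norm_apply_le (x - ξ) i).trans (hξ.trans hgX)
    rw [abs_le] at hi
    exact ⟨by linarith, by linarith⟩
  refine (lintegral_mono_set hsub).trans ?_
  rw [lintegral_slices_closedBall d hd t W x hg_meas
    (f := fun w => ENNReal.ofReal (Real.exp (-2 * l * w))) (by fun_prop)]
  refine mul_le_mul_right (le_of_eq ?_) _
  refine setLIntegral_congr_fun measurableSet_Ioi fun w hw => ?_
  have hgw := hg_nonneg w (hW.trans (mem_Ioi.mp hw).le)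
  simp only [ENNReal.ofReal_mul (pow_nonneg hgw d), ENNReal.ofReal_pow hgw]
end

section
/- Let d be a positive natural number, R > 0 and 0 ≤ r ≤ 2R, and let x, y ∈ ℝ^d with Euclidean distance |x − y| = r. Then the Lebesgue volume of the intersection of the two closed Euclidean balls of radius R centred at x and y equals (π^{(d−1)/2} / Γ((d−1)/2 + 1)) · R^d · ∫₀^{1 − (r/(2R))²} u^{(d−1)/2} (1−u)^{−1/2} du. -/
open MeasureTheory Real Set

/-- The volume of the Euclidean ball of radius `ρ` in `Fin n → ℝ`, including the case `n = 0`. -/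
lemma volume_sum_sq_le (n : ℕ) {ρ : ℝ} (hρ : 0 ≤ ρ) :
    volume {w : Fin n → ℝ | ∑ i, w i ^ 2 ≤ ρ ^ 2} =
      ENNReal.ofReal (π ^ ((n : ℝ) / 2) / Real.Gamma ((n : ℝ) / 2 + 1) * ρ ^ n) := by
  rcases n with _ | n
  · have : {w : Fin 0 → ℝ | ∑ i, w i ^ 2 ≤ ρ ^ 2} = univ := by
      ext w
      simp [sq_nonneg]
    rw [this]
    simp [Measure.volume_pi_eq_dirac (0 : Fin 0 → ℝ)]
  · have h : {w : Fin (n + 1) → ℝ | ∑ i, w i ^ 2 ≤ ρ ^ 2} =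
        (WithLp.toLp 2) ⁻¹' Metric.closedBall (0 : EuclideanSpace ℝ (Fin (n + 1))) ρ := by
      ext w
      rw [EuclideanSpace.closedBall_zero_eq _ hρ]
      simp
    rw [h, (PiLp.volume_preserving_toLp (Fin (n + 1))).measure_preimage
      Metric.isClosed_closedBall.measurableSet.nullMeasurableSet,
      EuclideanSpace.volume_closedBall, Fintype.card_fin, ← ENNReal.ofReal_pow hρ,
      ← ENNReal.ofReal_mul (by positivity), mul_comm]
    congr 3
    rw [Real.sqrt_eq_rpow, ← Real.rpow_natCast, ← Real.rpow_mul pi_pos.le]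
    congr 1
    ring

lemma exists_orthonormalBasis_sub_eq_smul (n : ℕ) (x y : EuclideanSpace ℝ (Fin (n + 1))) :
    ∃ b : OrthonormalBasis (Fin (n + 1)) ℝ (EuclideanSpace ℝ (Fin (n + 1))),
      y - x = dist x y • b 0 := by
  rcases eq_or_ne x y with rfl | hne
  · exact ⟨EuclideanSpace.basisFun _ ℝ, by simp⟩
  · have h0 : ‖y - x‖ ≠ 0 := by simpa [sub_eq_zero] using hne.symm
    obtain ⟨b, hb⟩ := Orthonormal.exists_orthonormalBasis_extension_of_card_eq
      (𝕜 := ℝ) (E := EuclideanSpace ℝ (Fin (n + 1))) (ι := Fin (n + 1)) (by simp)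
      (v := fun _ => ‖y - x‖⁻¹ • (y - x)) (s := {0}) (by
        constructor
        · intro i
          simp [norm_smul, h0]
        · intro i j hij
          exact absurd (Subsingleton.elim i j) hij)
    refine ⟨b, ?_⟩
    rw [hb 0 rfl, dist_comm, dist_eq_norm, smul_smul, mul_inv_cancel₀ h0, one_smul]

lemma abs_add_sq_add_le_iff {t a q c : ℝ} (ha : 0 ≤ a) :
    (|t| + a) ^ 2 + q ≤ c ↔ (t + a) ^ 2 + q ≤ c ∧ (t - a) ^ 2 + q ≤ c := by
  rcases abs_cases t with ⟨h, h'⟩ | ⟨h, h'⟩ <;> rw [h] <;> constructor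
  · intro H
    constructor <;> nlinarith [mul_nonneg ha h']
  · exact fun H => H.1
  · intro H
    constructor <;> nlinarith [mul_nonneg ha (neg_nonneg.2 h'.le)]
  · intro H
    nlinarith [H.2]

/-- In coordinates adapted to the line through the centres, with origin at their midpoint, the
intersection of two balls of equal radius becomes a symmetric lens. -/
lemma volume_closedBall_inter_eq_volume_lens (n : ℕ) {R : ℝ} (hR : 0 ≤ R)
    (x y : EuclideanSpace ℝ (Fin (n + 1))) :
    volume (Metric.closedBall x R ∩ Metric.closedBall y R) =
      volume {p : ℝ × (Fin n → ℝ) |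
        (|p.1| + dist x y / 2) ^ 2 + ∑ i, p.2 i ^ 2 ≤ R ^ 2} := by
  obtain ⟨b, hb⟩ := exists_orthonormalBasis_sub_eq_smul n x y
  set a := dist x y / 2 with ha
  have ha0 : 0 ≤ a := by positivity
  set m := x + a • b 0 with hm
  have hy : y = m + a • b 0 := by
    rw [hm, add_assoc, ← add_smul, ha, add_halves, ← hb]
    abel
  have hx : x = m - a • b 0 := by rw [hm]; abel
  have hmp := (volume_preserving_piFinSuccAbove (fun _ : Fin (n + 1) => ℝ) 0).comp
    ((PiLp.volume_preserving_ofLp (Fin (n + 1))).comp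
      (b.measurePreserving_repr.comp (measurePreserving_sub_right volume m)))
  have hS : MeasurableSet {p : ℝ × (Fin n → ℝ) |
      (|p.1| + a) ^ 2 + ∑ i, p.2 i ^ 2 ≤ R ^ 2} :=
    (isClosed_le (by fun_prop) (by fun_prop)).measurableSet
  rw [← hmp.measure_preimage hS.nullMeasurableSet]
  congr 1
  ext z
  have key (c : ℝ) : dist z (m + c • b 0) ≤ R ↔
      ((b.repr (z - m)) 0 - c) ^ 2 + ∑ i : Fin n, (b.repr (z - m)) i.succ ^ 2 ≤ R ^ 2 := by
    rw [dist_eq_norm, ← b.repr.norm_map, ← abs_norm, ← sq_le_sq₀ (abs_nonneg _) hR, sq_abs,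
      EuclideanSpace.norm_sq_eq, Fin.sum_univ_succ]
    have h : z - (m + c • b 0) = (z - m) - c • b 0 := by abel
    rw [h]
    simp [b.repr_self]
  have hx' := key (-a)
  rw [neg_smul, ← sub_eq_add_neg, ← hx, sub_neg_eq_add] at hx'
  have hy' := key a
  rw [← hy] at hy'
  rw [mem_inter_iff, Metric.mem_closedBall, Metric.mem_closedBall, hx', hy',
    ← abs_add_sq_add_le_iff ha0]
  simp [MeasurableEquiv.piFinSuccAbove, Fin.insertNthEquiv, Fin.tail]

lemma volume_lens (n : ℕ) {R a : ℝ} (ha : 0 ≤ a) (haR : a ≤ R) :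
    volume {p : ℝ × (Fin n → ℝ) | (|p.1| + a) ^ 2 + ∑ i, p.2 i ^ 2 ≤ R ^ 2} =
      ENNReal.ofReal (π ^ ((n : ℝ) / 2) / Real.Gamma ((n : ℝ) / 2 + 1) *
        (2 * ∫ s in a..R, √(R ^ 2 - s ^ 2) ^ n)) := by
  set c := π ^ ((n : ℝ) / 2) / Real.Gamma ((n : ℝ) / 2 + 1) with hc
  have hc0 : 0 ≤ c := div_nonneg (by positivity) (Real.Gamma_pos_of_pos (by positivity)).le
  have hS : MeasurableSet {p : ℝ × (Fin n → ℝ) |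
      (|p.1| + a) ^ 2 + ∑ i, p.2 i ^ 2 ≤ R ^ 2} :=
    (isClosed_le (by fun_prop) (by fun_prop)).measurableSet
  let g : ℝ → ℝ := fun s => c * √(R ^ 2 - (s + a) ^ 2) ^ n
  have hg : Continuous g := by fun_prop
  have hg0 (s : ℝ) : 0 ≤ g s := by positivity
  let G : ℝ → ℝ := (Iic (R - a)).indicator g
  have hslice (t : ℝ) : volume (Prod.mk t ⁻¹' {p : ℝ × (Fin n → ℝ) |
      (|p.1| + a) ^ 2 + ∑ i, p.2 i ^ 2 ≤ R ^ 2}) = ENNReal.ofReal (G |t|) := by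
    by_cases ht : |t| ≤ R - a
    · have h0 : 0 ≤ R ^ 2 - (|t| + a) ^ 2 := by nlinarith [abs_nonneg t]
      rw [show G |t| = g |t| from indicator_of_mem (mem_Iic.2 ht) g,
        ← volume_sum_sq_le n (Real.sqrt_nonneg _), Real.sq_sqrt h0]
      congr 1
      ext w
      simp [le_sub_iff_add_le']
    · rw [show G |t| = 0 from indicator_of_notMem (by simpa using ht) g, ENNReal.ofReal_zero]
      convert! measure_empty
      · ext w
        have := Finset.sum_nonneg (fun i (_ : i ∈ Finset.univ) => sq_nonneg (w i))
        simp only [mem_preimage, mem_ofPred_eq, mem_empty_iff_false, iff_false, not_le]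
        nlinarith [abs_nonneg t]
      · infer_instance
  have hGabs : (fun t => G |t|) = (Icc (-(R - a)) (R - a)).indicator (fun t => g |t|) := by
    ext t
    simp only [G, indicator, mem_Iic, mem_Icc, abs_le]
  have hint : Integrable (fun t => G |t|) := by
    rw [hGabs, integrable_indicator_iff measurableSet_Icc]
    exact (hg.comp continuous_abs).continuousOn.integrableOn_Icc
  rw [Measure.volume_eq_prod, Measure.prod_apply hS]
  simp_rw [hslice]
  rw [← ofReal_integral_eq_lintegral_ofReal hint
    (Filter.Eventually.of_forall fun t => indicator_nonneg (fun s _ => hg0 s) _),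
    integral_comp_abs]
  congr 1
  have h1 : ∫ s in Ioi 0, G s = ∫ s in 0..(R - a), g s := by
    rw [setIntegral_indicator measurableSet_Iic, Ioi_inter_Iic,
      intervalIntegral.integral_of_le (by linarith)]
  rw [h1]
  simp only [g]
  rw [intervalIntegral.integral_const_mul,
    intervalIntegral.integral_comp_add_right (fun s => √(R ^ 2 - s ^ 2) ^ n) a]
  simp
  ring

lemma integral_sqrt_sq_sub_sq_pow (n : ℕ) {R a : ℝ} (hR : 0 < R) (ha : 0 ≤ a) (haR : a ≤ R) :
    2 * ∫ s in a..R, √(R ^ 2 - s ^ 2) ^ n =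
      R ^ (n + 1) * ∫ u in (0 : ℝ)..(1 - (a / R) ^ 2),
        u ^ ((n : ℝ) / 2) * (1 - u) ^ (-(1 : ℝ) / 2) := by
  have hq : a / R ≤ 1 := (div_le_one hR).2 haR
  have hq0 : 0 ≤ a / R := by positivity
  have himg : (fun s : ℝ => 1 - (s / R) ^ 2) '' Ioo a R = Ioo 0 (1 - (a / R) ^ 2) := by
    ext u
    constructor
    · rintro ⟨s, ⟨h1, h2⟩, rfl⟩
      have h3 : a / R < s / R := by gcongr
      have h4 : s / R < 1 := (div_lt_one hR).2 h2
      constructor <;> dsimp only <;> nlinarith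
    · rintro ⟨h1, h2⟩
      refine ⟨R * √(1 - u), ⟨?_, ?_⟩, ?_⟩
      · have := Real.lt_sqrt_of_sq_lt (x := a / R) (y := 1 - u) (by linarith)
        rwa [div_lt_iff₀' hR] at this
      · have : √(1 - u) < 1 := by
          rw [Real.sqrt_lt' one_pos]; linarith
        nlinarith
      · have h3 : 0 ≤ 1 - u := by nlinarith
        simp only
        rw [mul_div_cancel_left₀ _ hR.ne', Real.sq_sqrt h3]
        ring
  have hderiv : ∀ s ∈ Ioo a R, HasDerivWithinAt (fun s : ℝ => 1 - (s / R) ^ 2)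
      (-(2 * s / R ^ 2)) (Ioo a R) s := by
    intro s _
    have := (((hasDerivAt_id s).div_const R).pow 2).const_sub 1
    refine (this.congr_deriv ?_).hasDerivWithinAt
    simp
    field_simp
  have hinj : InjOn (fun s : ℝ => 1 - (s / R) ^ 2) (Ioo a R) := by
    intro s hs t ht hst
    have h1 : (s / R) ^ 2 = (t / R) ^ 2 := by simpa using hst
    have hs0 : 0 ≤ s / R := div_nonneg (ha.trans hs.1.le) hR.le
    have ht0 : 0 ≤ t / R := div_nonneg (ha.trans ht.1.le) hR.le
    have h2 := (sq_eq_sq₀ hs0 ht0).1 h1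
    exact (div_left_inj' hR.ne').1 h2
  rw [intervalIntegral.integral_of_le haR, intervalIntegral.integral_of_le (by nlinarith),
    integral_Ioc_eq_integral_Ioo, integral_Ioc_eq_integral_Ioo, ← himg,
    integral_image_eq_integral_abs_deriv_smul measurableSet_Ioo hderiv hinj,
    ← integral_const_mul, ← integral_const_mul]
  refine setIntegral_congr_fun measurableSet_Ioo fun s hs => ?_
  have hs0 : 0 < s := ha.trans_lt hs.1
  have h0 : 0 ≤ 1 - (s / R) ^ 2 := by
    have h4 : s / R < 1 := (div_lt_one hR).2 hs.2
    have : 0 < s / R := by positivity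
    nlinarith
  have h1 : √(R ^ 2 - s ^ 2) = R * √(1 - (s / R) ^ 2) := by
    rw [← Real.sqrt_sq hR.le, ← Real.sqrt_mul (sq_nonneg _), Real.sqrt_sq hR.le]
    congr 1
    field_simp
  have h2 : (1 - (s / R) ^ 2) ^ ((n : ℝ) / 2) = √(1 - (s / R) ^ 2) ^ n := by
    rw [Real.sqrt_eq_rpow, ← Real.rpow_natCast _ n, ← Real.rpow_mul h0]
    congr 1
    ring
  have h3 : (1 - (1 - (s / R) ^ 2)) ^ (-(1 : ℝ) / 2) = R / s := by
    rw [sub_sub_cancel, neg_div, Real.rpow_neg (by positivity), ← Real.sqrt_eq_rpow,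
      Real.sqrt_sq (by positivity), inv_div]
  simp only [smul_eq_mul]
  rw [h1, h2, h3, abs_neg, abs_of_nonneg (by positivity), mul_pow]
  field_simp
  ring

/-- The volume of the intersection of two closed balls of equal radius `R` in `ℝ^d`
whose centres are at distance `r ≤ 2R` equals
`(π^{(d-1)/2}/Γ((d-1)/2+1)) R^d ∫₀^{1-(r/(2R))²} u^{(d-1)/2}(1-u)^{-1/2} du`,
i.e. twice the volume of a spherical cap, expressed via the incomplete beta function. -/
theorem stmt16 (d : ℕ) (hd : 0 < d) (R r : ℝ) (hR : 0 < R) (hr : 0 ≤ r) (hr2 : r ≤ 2 * R)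
    (x y : EuclideanSpace ℝ (Fin d)) (hxy : dist x y = r) :
    volume (Metric.closedBall x R ∩ Metric.closedBall y R)
      = ENNReal.ofReal
          (π ^ (((d : ℝ) - 1) / 2) / Real.Gamma (((d : ℝ) - 1) / 2 + 1) * R ^ d *
            ∫ u in (0 : ℝ)..(1 - (r / (2 * R)) ^ 2),
              u ^ (((d : ℝ) - 1) / 2) * (1 - u) ^ (-(1 : ℝ) / 2)) := by
  obtain ⟨n, rfl⟩ := Nat.exists_eq_succ_of_ne_zero hd.ne'
  rw [volume_closedBall_inter_eq_volume_lens n hR.le x y, hxy,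
    volume_lens n (by positivity) (by linarith),
    integral_sqrt_sq_sub_sq_pow n hR (by positivity) (by linarith)]
  simp only [Nat.succ_eq_add_one, Nat.cast_add, Nat.cast_one, add_sub_cancel_right, div_div,
    mul_assoc]
end

section
/- Fix a grid spacing Δ > 0 and an integer m ≥ 2. For a parameter vector θ = (α, β, c, E, V) with α > 2, β > 0, c > 0, E ∈ ℝ and V > 0, define μ(θ) = 2cβ²E/((α−2)(α−1)), σ²(θ) = cβ²V/(2(α−2)(α−1)), κ_X(θ,h) = cβ^αV/(2(β + hΔ/c)^{α−2}(α−2)(α−1)) and κ_T(θ,h) = cβ^αV/(2(β + hΔ)^{α−2}(α−2)(α−1)) for h = 1, …, m. If two parameter vectors θ and θ₀ in this region satisfy μ(θ) = μ(θ₀), σ²(θ) = σ²(θ₀), κ_X(θ,h) = κ_X(θ₀,h) and κ_T(θ,h) = κ_T(θ₀,h) for all h = 1, …, m, then θ = θ₀. -/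
theorem eq_of_div_eq_div_left {a b c : ℝ} (ha : a ≠ 0) (h : a / b = a / c) : b = c := by
  rw [div_eq_mul_inv, div_eq_mul_inv] at h
  exact inv_injective (mul_left_cancel₀ ha h)

/-- If `(1 + x) ^ a = (1 + y) ^ b` and `(1 + 2x) ^ a = (1 + 2y) ^ b`, then `a ≤ b`, since
otherwise strict convexity of `t ↦ t ^ (a / b)` fails at `1, 1 + x, 1 + 2x`. -/
theorem le_of_rpow_one_add_eq {a b x y : ℝ} (hb : 0 < b) (hx : 0 < x) (hy : 0 < y)
    (h₁ : (1 + x) ^ a = (1 + y) ^ b) (h₂ : (1 + 2 * x) ^ a = (1 + 2 * y) ^ b) : a ≤ b := by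
  by_contra! hab
  have key : ∀ s t : ℝ, 0 < s → 0 < t → s ^ a = t ^ b → s ^ (a / b) = t := by
    intro s t hs ht h
    rw [div_eq_mul_inv, Real.rpow_mul hs.le, h, Real.rpow_rpow_inv ht.le hb.ne']
  have e₁ := key _ _ (by positivity) (by positivity) h₁
  have e₂ := key _ _ (by positivity) (by positivity) h₂
  have hconv := (strictConvexOn_rpow ((one_lt_div hb).2 hab)).2
    (Set.mem_Ici.2 zero_le_one) (Set.mem_Ici.2 (by positivity : (0 : ℝ) ≤ 1 + 2 * x))
    (by linarith) (by norm_num : (0 : ℝ) < 1 / 2) (by norm_num : (0 : ℝ) < 1 / 2) (by norm_num)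
  simp only [smul_eq_mul, Real.one_rpow, e₂] at hconv
  rw [show (1 / 2 * 1 + 1 / 2 * (1 + 2 * x) : ℝ) = 1 + x by ring, e₁] at hconv
  linarith

theorem eq_and_eq_of_rpow_one_add_eq {a b x y : ℝ} (ha : 0 < a) (hb : 0 < b)
    (hx : 0 < x) (hy : 0 < y) (h₁ : (1 + x) ^ a = (1 + y) ^ b)
    (h₂ : (1 + 2 * x) ^ a = (1 + 2 * y) ^ b) : a = b ∧ x = y := by
  have hab : a = b := le_antisymm (le_of_rpow_one_add_eq hb hx hy h₁ h₂)
    (le_of_rpow_one_add_eq ha hy hx h₁.symm h₂.symm)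
  subst hab
  have := (Real.rpow_left_inj (by positivity) (by positivity) ha.ne').1 h₁
  exact ⟨rfl, by linarith⟩

/-- The autocovariance at displacement `t` is the variance divided by
`(1 + t / β) ^ (α - 2)`. -/
theorem autocovariance_eq_variance_div {α β t : ℝ} (c V : ℝ) (hβ : 0 < β) (ht : 0 < t) :
    c * β ^ α * V / (2 * (β + t) ^ (α - 2) * (α - 2) * (α - 1))
      = c * β ^ 2 * V / (2 * (α - 2) * (α - 1)) / (1 + t / β) ^ (α - 2) := by
  have h₁ : β ^ α = β ^ (α - 2) * β ^ 2 := by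
    rw [← Real.rpow_natCast β 2, ← Real.rpow_add hβ]
    norm_num
  have h₂ : (β + t) ^ (α - 2) = β ^ (α - 2) * (1 + t / β) ^ (α - 2) := by
    rw [← Real.mul_rpow hβ.le (by positivity)]
    congr 1
    field_simp
  have h₃ : β ^ (α - 2) ≠ 0 := (Real.rpow_pos_of_pos hβ _).ne'
  rw [h₁, h₂, div_div, show c * (β ^ (α - 2) * β ^ 2) * V = β ^ (α - 2) * (c * β ^ 2 * V) by ring,
    show 2 * (β ^ (α - 2) * (1 + t / β) ^ (α - 2)) * (α - 2) * (α - 1)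
      = β ^ (α - 2) * (2 * (α - 2) * (α - 1) * (1 + t / β) ^ (α - 2)) by ring,
    mul_div_mul_left _ _ h₃]

/-- GMM identifiability for the MSTOU process in one spatial dimension: the mean
`μ(θ) = 2cβ²E/((α-2)(α-1))`, variance `σ²(θ) = cβ²V/(2(α-2)(α-1))`, spatial
autocovariances `κ_X(θ,h) = cβ^αV/(2(β+hΔ/c)^{α-2}(α-2)(α-1))` and temporal
autocovariances `κ_T(θ,h) = cβ^αV/(2(β+hΔ)^{α-2}(α-2)(α-1))` at lags `h = 1, …, m`
(with `m ≥ 2`) jointly identify the parameter vector `θ = (α, β, c, E, V)` in the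
region `α > 2`, `β > 0`, `c > 0`, `V > 0`. -/
theorem stmt19 (Δ : ℝ) (hΔ : 0 < Δ) (m : ℕ) (hm : 2 ≤ m)
    (α β c E V α₀ β₀ c₀ E₀ V₀ : ℝ)
    (hα : 2 < α) (hβ : 0 < β) (hc : 0 < c) (hV : 0 < V)
    (hα₀ : 2 < α₀) (hβ₀ : 0 < β₀) (hc₀ : 0 < c₀) (hV₀ : 0 < V₀)
    (hμ : 2 * c * β ^ 2 * E / ((α - 2) * (α - 1))
        = 2 * c₀ * β₀ ^ 2 * E₀ / ((α₀ - 2) * (α₀ - 1)))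
    (hσ : c * β ^ 2 * V / (2 * (α - 2) * (α - 1))
        = c₀ * β₀ ^ 2 * V₀ / (2 * (α₀ - 2) * (α₀ - 1)))
    (hκX : ∀ h : ℕ, 1 ≤ h → h ≤ m →
      c * β ^ α * V / (2 * (β + (h : ℝ) * Δ / c) ^ (α - 2) * (α - 2) * (α - 1))
        = c₀ * β₀ ^ α₀ * V₀ /
            (2 * (β₀ + (h : ℝ) * Δ / c₀) ^ (α₀ - 2) * (α₀ - 2) * (α₀ - 1)))
    (hκT : ∀ h : ℕ, 1 ≤ h → h ≤ m →
      c * β ^ α * V / (2 * (β + (h : ℝ) * Δ) ^ (α - 2) * (α - 2) * (α - 1))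
        = c₀ * β₀ ^ α₀ * V₀ /
            (2 * (β₀ + (h : ℝ) * Δ) ^ (α₀ - 2) * (α₀ - 2) * (α₀ - 1))) :
    α = α₀ ∧ β = β₀ ∧ c = c₀ ∧ E = E₀ ∧ V = V₀ := by
  have ha : 0 < α - 2 := by linarith
  have ha₀ : 0 < α₀ - 2 := by linarith
  have hb : 0 < α - 1 := by linarith
  have hb₀ : 0 < α₀ - 1 := by linarith
  have hvar : c₀ * β₀ ^ 2 * V₀ / (2 * (α₀ - 2) * (α₀ - 1)) ≠ 0 := by positivity
  have cancel : ∀ t t₀ : ℝ, 0 < t → 0 < t₀ →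
      c * β ^ α * V / (2 * (β + t) ^ (α - 2) * (α - 2) * (α - 1))
        = c₀ * β₀ ^ α₀ * V₀ / (2 * (β₀ + t₀) ^ (α₀ - 2) * (α₀ - 2) * (α₀ - 1)) →
      (1 + t / β) ^ (α - 2) = (1 + t₀ / β₀) ^ (α₀ - 2) := by
    intro t t₀ ht ht₀ h
    rw [autocovariance_eq_variance_div c V hβ ht, autocovariance_eq_variance_div c₀ V₀ hβ₀ ht₀,
      hσ] at h
    exact eq_of_div_eq_div_left hvar h
  have hT₁ := cancel _ _ (by positivity) (by positivity) (hκT 1 le_rfl (by omega))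
  have hT₂ := cancel _ _ (by positivity) (by positivity) (hκT 2 (by omega) hm)
  have hX := cancel _ _ (by positivity) (by positivity) (hκX 1 le_rfl (by omega))
  simp only [Nat.cast_one, one_mul, Nat.cast_ofNat, mul_div_assoc] at hT₁ hT₂ hX
  obtain ⟨hα_eq, hβ_eq⟩ := eq_and_eq_of_rpow_one_add_eq ha ha₀ (by positivity) (by positivity)
    hT₁ hT₂
  obtain rfl : α = α₀ := by linarith
  obtain rfl : β = β₀ := eq_of_div_eq_div_left hΔ.ne' hβ_eq
  have hX' := add_left_cancel
    ((Real.rpow_left_inj (by positivity) (by positivity) ha.ne').1 hX)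
  obtain rfl : c = c₀ := eq_of_div_eq_div_left hΔ.ne' ((div_left_inj' hβ.ne').1 hX')
  refine ⟨rfl, rfl, rfl, ?_, ?_⟩
  · exact mul_left_cancel₀ (by positivity) ((div_left_inj' (by positivity)).1 hμ)
  · exact mul_left_cancel₀ (by positivity) ((div_left_inj' (by positivity)).1 hσ)
end
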